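/- arXiv:1212.6467 — 2 statements merged into one kernel-verified Lean document; each statement's English description precedes it below -/
import Mathlib

section
/- Let ρ and ρ' be two fixed paths in a higraph and let k ≥ 1. Then the number of k-step gluing sequences starting at ρ and terminating at ρ' is a multiple of k!. -/
/-!
Statement 0: Let ρ and ρ' be two fixed paths in a higraph and let k ≥ 1.  Then the number of
k-step gluing sequences starting at ρ and terminating at ρ' is a multiple of k!.
-/

open scoped Classical

noncomputable section

variable {V : Type*}

/-- Raw combinatorial data of a path in a directed hypergraph: a finite set of nodes
(drawn from ℕ), a finite set of arrows, and a labeling of the nodes by hypergraph edges. -/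
structure RawPath (V : Type*) where
  nodes : Finset ℕ
  arrows : Finset (ℕ × ℕ)
  label : ℕ → Finset V × Finset V

/-- The underlying undirected simple graph of the arrow set, on the node set. -/
def RawPath.graph (r : RawPath V) : SimpleGraph {x // x ∈ r.nodes} :=
  SimpleGraph.fromRel (fun a b => ((a : ℕ), (b : ℕ)) ∈ r.arrows)

/-- The underlying data forms a (finite) non-empty directed tree. -/
def RawPath.IsDirTree (r : RawPath V) : Prop :=
  r.nodes.Nonempty ∧
  (∀ e ∈ r.arrows, e.1 ∈ r.nodes ∧ e.2 ∈ r.nodes ∧ e.1 ≠ e.2) ∧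
  (∀ a b : ℕ, (a, b) ∈ r.arrows → (b, a) ∉ r.arrows) ∧
  r.graph.IsTree

/-- A higraph: a directed hypergraph (edges are pairs of finite sets of vertices) satisfying
the transitivity and acyclicity properties. -/
structure Higraph (V : Type*) where
  E : Set (Finset V × Finset V)
  transitive : ∀ e ∈ E, ∀ e' ∈ E, (e.2 ∩ e'.1).Nonempty →
    ∃ K : V, e.2 ∩ e'.1 = {K} ∧
      Disjoint e.1 (e'.1 \ {K}) ∧ Disjoint (e.2 \ {K}) e'.2 ∧
      (e.1 ∪ (e'.1 \ {K}), (e.2 \ {K}) ∪ e'.2) ∈ E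
  acyclic : ∀ e ∈ E, ∀ e' ∈ E, (e.2 ∩ e'.1).Nonempty → (e'.2 ∩ e.1).Nonempty →
    ∃ K : V, e = ({K}, {K}) ∧ e' = ({K}, {K})

/-- `r` is a path in the higraph `H`: its underlying data is a non-empty directed tree,
its nodes are labeled by edges of `H`, for each arrow the intersection of the target of the
label of its source node with the source of the label of its target node is a singleton
(the break vertex), and distinct arrows sharing a source node or a target node have distinct
break vertices. -/
def IsPath (H : Higraph V) (r : RawPath V) : Prop :=
  r.IsDirTree ∧
  (∀ v ∈ r.nodes, r.label v ∈ H.E) ∧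
  (∀ e ∈ r.arrows, ∃ K : V, (r.label e.1).2 ∩ (r.label e.2).1 = {K}) ∧
  (∀ e ∈ r.arrows, ∀ e' ∈ r.arrows, e ≠ e' → (e.1 = e'.1 ∨ e.2 = e'.2) →
    (r.label e.1).2 ∩ (r.label e.2).1 ≠ (r.label e'.1).2 ∩ (r.label e'.2).1)

/-- Gluing a path at a break `e` : contract the arrow `e` of the underlying tree (keeping the
node `e.1` as the contracted node `v*`), and label the contracted node by the edge
`(s(ρ'), t(ρ'))` where `ρ'` is the two-node subpath spanned by `e`. -/
def glue (r : RawPath V) (e : ℕ × ℕ) : RawPath V where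
  nodes := r.nodes.erase e.2
  arrows := (r.arrows.erase e).image (fun p =>
    (if p.1 = e.2 then e.1 else p.1, if p.2 = e.2 then e.1 else p.2))
  label := fun x =>
    if x = e.1 then
      ((r.label e.1).1 ∪ ((r.label e.2).1 \ (r.label e.1).2),
       ((r.label e.1).2 \ (r.label e.2).1) ∪ (r.label e.2).2)
    else r.label x

/-- Isomorphism of raw paths: a relabeling of the nodes which identifies node sets, arrow
sets and labels. -/
def RawIso (r₁ r₂ : RawPath V) : Prop :=
  ∃ f : Equiv.Perm ℕ,
    (∀ x : ℕ, x ∈ r₁.nodes ↔ f x ∈ r₂.nodes) ∧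
    (∀ a b : ℕ, a ∈ r₁.nodes → b ∈ r₁.nodes →
      ((a, b) ∈ r₁.arrows ↔ (f a, f b) ∈ r₂.arrows)) ∧
    (∀ v ∈ r₁.nodes, r₂.label (f v) = r₁.label v)

/-- `l` is a gluing sequence on `r`: each entry is a break (arrow) of the path obtained by
performing the previous gluings. -/
def IsGlueSeq : RawPath V → List (ℕ × ℕ) → Prop
  | _, [] => True
  | r, e :: l => e ∈ r.arrows ∧ IsGlueSeq (glue r e) l

/-- The result of performing the gluings in the list `l`, one after the other. -/
def glueIter (r : RawPath V) (l : List (ℕ × ℕ)) : RawPath V := l.foldl glue r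

/-- The node map of the contraction of the arrow `e`. -/
def mergeNode (e : ℕ × ℕ) (x : ℕ) : ℕ := if x = e.2 then e.1 else x

/-- The arrow map of the contraction of the arrow `e`. -/
def mergeArrow (e p : ℕ × ℕ) : ℕ × ℕ := (mergeNode e p.1, mergeNode e p.2)

/-- Any two nodes in `N` are joined by a chain of arrows in `A`. -/
def ArrowConnected (N : Finset ℕ) (A : Finset (ℕ × ℕ)) : Prop :=
  ∀ x ∈ N, ∀ y ∈ N, Relation.EqvGen (fun a b => (a, b) ∈ A) x y

theorem ArrowConnected.contract {N : Finset ℕ} {A : Finset (ℕ × ℕ)}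
    (h : ArrowConnected N A) (e : ℕ × ℕ) :
    ArrowConnected (N.erase e.2) ((A.erase e).image (mergeArrow e)) := by
  have key : ∀ u v, Relation.EqvGen (fun a b => (a, b) ∈ A) u v →
      Relation.EqvGen (fun a b => (a, b) ∈ (A.erase e).image (mergeArrow e))
        (mergeNode e u) (mergeNode e v) := by
    intro u v huv
    induction huv with
    | rel a b hab =>
      by_cases he : (a, b) = e
      · subst he
        have : mergeNode (a, b) a = mergeNode (a, b) b := by simp [mergeNode]
        rw [this]
        exact .refl _
      · exact .rel _ _ (Finset.mem_image.2 ⟨(a, b), Finset.mem_erase.2 ⟨he, hab⟩, rfl⟩)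
    | refl a => exact .refl _
    | symm a b _ ih => exact .symm _ _ ih
    | trans a b c _ _ ih₁ ih₂ => exact .trans _ _ _ ih₁ ih₂
  intro x hx y hy
  rw [Finset.mem_erase] at hx hy
  simpa [mergeNode, hx.1, hy.1] using key x y (h x hx.2 y hy.2)

theorem ArrowConnected.card_le {N : Finset ℕ} {A : Finset (ℕ × ℕ)}
    (h : ArrowConnected N A) : N.card ≤ A.card + 1 := by
  induction hn : A.card using Nat.strong_induction_on generalizing N A with
  | _ n ih =>
    rcases A.eq_empty_or_nonempty with rfl | ⟨e, he⟩
    · have : N.card ≤ 1 := by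
        refine Finset.card_le_one.2 fun x hx y hy => ?_
        have hxy := h x hx y hy
        clear hx hy
        induction hxy with
        | rel a b hab => simp at hab
        | refl a => rfl
        | symm a b _ ih => exact ih.symm
        | trans a b c _ _ ih₁ ih₂ => exact ih₁.trans ih₂
      omega
    · have h₁ := Finset.card_erase_lt_of_mem he
      have h₂ : ((A.erase e).image (mergeArrow e)).card ≤ (A.erase e).card :=
        Finset.card_image_le
      have h₃ := ih _ (by omega) (h.contract e) rfl
      have h₄ := Finset.pred_card_le_card_erase (s := N) (a := e.2)
      omega

theorem ArrowConnected.of_imp {N : Finset ℕ} {A B : Finset (ℕ × ℕ)} (h : ArrowConnected N A)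
    (hAB : ∀ a b, (a, b) ∈ A → Relation.EqvGen (fun a b => (a, b) ∈ B) a b) :
    ArrowConnected N B := by
  intro x hx y hy
  have hxy := h x hx y hy
  clear hx hy
  induction hxy with
  | rel a b hab => exact hAB a b hab
  | refl a => exact .refl _
  | symm a b _ ih => exact .symm _ _ ih
  | trans a b c _ _ ih₁ ih₂ => exact .trans _ _ _ ih₁ ih₂

/-- A connected directed graph with one node more than arrows. -/
structure IsArrowTree (N : Finset ℕ) (A : Finset (ℕ × ℕ)) : Prop where
  endpoints : ∀ e ∈ A, e.1 ∈ N ∧ e.2 ∈ N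
  connected : ArrowConnected N A
  card_le : A.card + 1 ≤ N.card

namespace IsArrowTree

variable {N : Finset ℕ} {A : Finset (ℕ × ℕ)}

theorem not_connected_erase (h : IsArrowTree N A) {e : ℕ × ℕ} (he : e ∈ A) :
    ¬ ArrowConnected N (A.erase e) := by
  intro hc
  have h₁ := hc.card_le
  have h₂ := Finset.card_erase_lt_of_mem he
  have h₃ := h.card_le
  omega

theorem ne (h : IsArrowTree N A) {e : ℕ × ℕ} (he : e ∈ A) : e.1 ≠ e.2 := by
  intro hl
  refine h.not_connected_erase he (h.connected.of_imp fun a b hab => ?_)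
  by_cases hab' : (a, b) = e
  · subst hab'
    obtain rfl : a = b := hl
    exact .refl _
  · exact .rel _ _ (Finset.mem_erase.2 ⟨hab', hab⟩)

theorem swap_notMem (h : IsArrowTree N A) {a b : ℕ} (he : (a, b) ∈ A) : (b, a) ∉ A := by
  intro hr
  have hne : a ≠ b := h.ne he
  refine h.not_connected_erase he (h.connected.of_imp fun c d hcd => ?_)
  by_cases hcd' : (c, d) = (a, b)
  · obtain ⟨rfl, rfl⟩ := Prod.mk.inj hcd'
    exact .symm _ _ (.rel _ _ (Finset.mem_erase.2 ⟨by simp [hne], hr⟩))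
  · exact .rel _ _ (Finset.mem_erase.2 ⟨hcd', hcd⟩)

theorem injOn_mergeArrow (h : IsArrowTree N A) {e : ℕ × ℕ} (he : e ∈ A) :
    Set.InjOn (mergeArrow e) (A.erase e : Finset (ℕ × ℕ)) := by
  rw [← Finset.card_image_iff]
  refine le_antisymm Finset.card_image_le ?_
  have h₁ := (h.connected.contract e).card_le
  have h₂ := Finset.card_erase_of_mem he
  have h₃ := Finset.card_erase_of_mem (h.endpoints e he).2
  have h₄ := h.card_le
  omega

theorem contract (h : IsArrowTree N A) {e : ℕ × ℕ} (he : e ∈ A) :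
    IsArrowTree (N.erase e.2) ((A.erase e).image (mergeArrow e)) where
  endpoints := by
    have hne := h.ne he
    have h₁ := h.endpoints e he
    have key : ∀ x ∈ N, mergeNode e x ∈ N.erase e.2 := by
      intro x hx
      unfold mergeNode
      split_ifs with hxe
      · exact Finset.mem_erase.2 ⟨hne, h₁.1⟩
      · exact Finset.mem_erase.2 ⟨hxe, hx⟩
    intro p hp
    obtain ⟨q, hq, rfl⟩ := Finset.mem_image.1 hp
    have h₂ := h.endpoints q (Finset.mem_of_mem_erase hq)
    exact ⟨key _ h₂.1, key _ h₂.2⟩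
  connected := h.connected.contract e
  card_le := by
    have h₁ : ((A.erase e).image (mergeArrow e)).card ≤ (A.erase e).card :=
      Finset.card_image_le
    have h₂ := Finset.card_erase_of_mem he
    have h₃ := Finset.card_erase_of_mem (h.endpoints e he).2
    have h₄ := h.card_le
    have h₅ := Finset.card_pos.2 ⟨e, he⟩
    omega

theorem erase_eq_image (h : IsArrowTree N A) {e : ℕ × ℕ} (he : e ∈ A) :
    N.erase e.2 = N.image (mergeNode e) := by
  have hne := h.ne he
  have h₁ := h.endpoints e he
  ext x
  simp only [Finset.mem_erase, Finset.mem_image, mergeNode]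
  constructor
  · rintro ⟨hx, hxN⟩
    exact ⟨x, hxN, by simp [hx]⟩
  · rintro ⟨y, hy, rfl⟩
    split_ifs with hye
    · exact ⟨hne, h₁.1⟩
    · exact ⟨hye, hy⟩

end IsArrowTree

theorem RawPath.IsDirTree.isArrowTree {r : RawPath V} (h : r.IsDirTree) :
    IsArrowTree r.nodes r.arrows := by
  obtain ⟨-, hend, hanti, htree⟩ := h
  refine ⟨fun e he => ⟨(hend e he).1, (hend e he).2.1⟩, ?_, ?_⟩
  · intro x hx y hy
    obtain ⟨w⟩ := htree.1.preconnected ⟨x, hx⟩ ⟨y, hy⟩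
    have key : ∀ u v : {x // x ∈ r.nodes}, r.graph.Walk u v →
        Relation.EqvGen (fun a b => (a, b) ∈ r.arrows) (u : ℕ) (v : ℕ) := by
      intro u v w
      induction w with
      | nil => exact .refl _
      | cons hadj _ ih =>
        refine .trans _ _ _ ?_ ih
        rw [RawPath.graph, SimpleGraph.fromRel_adj] at hadj
        rcases hadj.2 with h | h
        · exact .rel _ _ h
        · exact .symm _ _ (.rel _ _ h)
    exact key _ _ w
  · have hcard := htree.card_edgeFinset
    rw [Fintype.card_coe] at hcard
    rw [← hcard]
    have hinj : Set.InjOn (fun p : ℕ × ℕ => s(p.1, p.2)) (r.arrows : Set (ℕ × ℕ)) := by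
      rintro ⟨a, b⟩ hab ⟨c, d⟩ hcd heq
      simp only [Sym2.eq_iff] at heq
      rcases heq with ⟨rfl, rfl⟩ | ⟨rfl, rfl⟩
      · rfl
      · exact absurd hcd (hanti _ _ hab)
    rw [← Finset.card_image_of_injOn hinj]
    refine Nat.succ_le_succ ((Finset.card_le_card ?_).trans
      (Finset.card_image_le (f := Sym2.map (Subtype.val : {x // x ∈ r.nodes} → ℕ))))
    intro z hz
    obtain ⟨⟨a, b⟩, hp, rfl⟩ := Finset.mem_image.1 hz
    obtain ⟨ha, hb, hne⟩ := hend _ hp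
    refine Finset.mem_image.2 ⟨s(⟨a, ha⟩, ⟨b, hb⟩), ?_, by simp⟩
    rw [SimpleGraph.mem_edgeFinset, SimpleGraph.mem_edgeSet, RawPath.graph,
      SimpleGraph.fromRel_adj]
    exact ⟨fun h => hne (congrArg Subtype.val h), Or.inl hp⟩

/-- The set of break vertices at the arrow `e`. -/
def RawPath.breakSet (r : RawPath V) (e : ℕ × ℕ) : Finset V :=
  (r.label e.1).2 ∩ (r.label e.2).1

theorem glue_label (r : RawPath V) (e : ℕ × ℕ) (x : ℕ) :
    (glue r e).label x = if x = e.1 then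
      ((r.label e.1).1 ∪ ((r.label e.2).1 \ r.breakSet e),
       ((r.label e.1).2 \ r.breakSet e) ∪ (r.label e.2).2)
    else r.label x := by
  simp [glue, RawPath.breakSet]

theorem glue_arrows (r : RawPath V) (e : ℕ × ℕ) :
    (glue r e).arrows = (r.arrows.erase e).image (mergeArrow e) := rfl

theorem glue_nodes (r : RawPath V) (e : ℕ × ℕ) :
    (glue r e).nodes = r.nodes.erase e.2 := rfl

/-- The properties of paths in a higraph that are preserved by gluing and suffice for
gluings to commute. -/
structure IsArrowPath (H : Higraph V) (r : RawPath V) : Prop where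
  tree : IsArrowTree r.nodes r.arrows
  label_mem : ∀ v ∈ r.nodes, r.label v ∈ H.E
  nonempty : ∀ e ∈ r.arrows, (r.breakSet e).Nonempty
  breakSet_ne : ∀ e ∈ r.arrows, ∀ e' ∈ r.arrows, e ≠ e' → (e.1 = e'.1 ∨ e.2 = e'.2) →
    r.breakSet e ≠ r.breakSet e'

theorem IsPath.isArrowPath {H : Higraph V} {r : RawPath V} (h : IsPath H r) :
    IsArrowPath H r where
  tree := h.1.isArrowTree
  label_mem := h.2.1
  nonempty e he := by
    obtain ⟨K, hK⟩ := h.2.2.1 e he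
    exact ⟨K, by simp [RawPath.breakSet, hK]⟩
  breakSet_ne := h.2.2.2

namespace IsArrowPath

variable {H : Higraph V} {r : RawPath V}

theorem exists_break (h : IsArrowPath H r) {e : ℕ × ℕ} (he : e ∈ r.arrows) :
    ∃ K, r.breakSet e = {K} ∧ K ∈ (r.label e.1).2 ∧ K ∈ (r.label e.2).1 ∧
      Disjoint (r.label e.1).1 ((r.label e.2).1 \ {K}) ∧
      Disjoint ((r.label e.1).2 \ {K}) (r.label e.2).2 ∧
      ((r.label e.1).1 ∪ ((r.label e.2).1 \ {K}),
        ((r.label e.1).2 \ {K}) ∪ (r.label e.2).2) ∈ H.E := by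
  have hend := h.tree.endpoints e he
  obtain ⟨K, hK, h₁, h₂, h₃⟩ := H.transitive _ (h.label_mem _ hend.1) _ (h.label_mem _ hend.2)
    (h.nonempty e he)
  have hmem : K ∈ (r.label e.1).2 ∩ (r.label e.2).1 := by simp [hK]
  rw [Finset.mem_inter] at hmem
  exact ⟨K, hK, hmem.1, hmem.2, h₁, h₂, h₃⟩

theorem glue_label_mem (h : IsArrowPath H r) {e : ℕ × ℕ} (he : e ∈ r.arrows) :
    ∀ v ∈ (glue r e).nodes, (glue r e).label v ∈ H.E := by
  intro v hv
  obtain ⟨K, hK, -, -, -, -, hE⟩ := h.exists_break he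
  rw [glue_label, hK]
  split_ifs with hve
  · exact hE
  · exact h.label_mem v (Finset.mem_of_mem_erase hv)

theorem breakSet_glue (h : IsArrowPath H r) {e p : ℕ × ℕ} (he : e ∈ r.arrows)
    (hp : p ∈ r.arrows) (hpe : p ≠ e) :
    (glue r e).breakSet (mergeArrow e p) = r.breakSet p := by
  obtain ⟨K, hK, -⟩ := h.exists_break he
  obtain ⟨L, hL, hL₁, hL₂, -⟩ := h.exists_break hp
  have hne := h.tree.ne he
  have hdist := h.breakSet_ne p hp e he hpe
  rw [hK, hL, Ne, Finset.singleton_inj] at hdist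
  have hmem : L ∈ (glue r e).breakSet (mergeArrow e p) := by
    rw [RawPath.breakSet, Finset.mem_inter, glue_label, glue_label, hK]
    simp only [mergeArrow, mergeNode]
    grind
  have hend := (h.tree.contract he).endpoints _
    (Finset.mem_image_of_mem (mergeArrow e) (Finset.mem_erase.2 ⟨hpe, hp⟩))
  obtain ⟨M, hM, -⟩ := H.transitive _ (h.glue_label_mem he _ hend.1) _
    (h.glue_label_mem he _ hend.2) ⟨L, hmem⟩
  change (glue r e).breakSet (mergeArrow e p) = {M} at hM
  rw [hM, Finset.mem_singleton] at hmem
  rw [hM, hL, hmem]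

theorem glue (h : IsArrowPath H r) {e : ℕ × ℕ} (he : e ∈ r.arrows) :
    IsArrowPath H (glue r e) where
  tree := h.tree.contract he
  label_mem := h.glue_label_mem he
  nonempty p hp := by
    obtain ⟨q, hq, rfl⟩ := Finset.mem_image.1 hp
    rw [Finset.mem_erase] at hq
    change ((_root_.glue r e).breakSet (mergeArrow e q)).Nonempty
    rw [h.breakSet_glue he hq.2 hq.1]
    exact h.nonempty q hq.2
  breakSet_ne p hp p' hp' hpp' hor := by
    obtain ⟨q, hq, rfl⟩ := Finset.mem_image.1 hp
    obtain ⟨q', hq', rfl⟩ := Finset.mem_image.1 hp'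
    rw [Finset.mem_erase] at hq hq'
    change (_root_.glue r e).breakSet (mergeArrow e q) ≠
      (_root_.glue r e).breakSet (mergeArrow e q')
    change mergeArrow e q ≠ mergeArrow e q' at hpp'
    change (mergeArrow e q).1 = (mergeArrow e q').1 ∨
      (mergeArrow e q).2 = (mergeArrow e q').2 at hor
    rw [h.breakSet_glue he hq.2 hq.1, h.breakSet_glue he hq'.2 hq'.1]
    have hqq' : q ≠ q' := fun hh => hpp' (by rw [hh])
    have hdist := h.breakSet_ne q hq.2 q' hq'.2 hqq'
    have hd₁ := h.breakSet_ne q hq.2 e he hq.1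
    have hd₂ := h.breakSet_ne q' hq'.2 e he hq'.1
    obtain ⟨K, hK, -, -, hs, ht, -⟩ := h.exists_break he
    obtain ⟨L, hL, hL₁, hL₂, -⟩ := h.exists_break hq.2
    obtain ⟨M, hM, hM₁, hM₂, -⟩ := h.exists_break hq'.2
    rw [hL, hM, Ne, Finset.singleton_inj] at hdist ⊢
    rw [hL, hK, Ne, Finset.singleton_inj] at hd₁
    rw [hM, hK, Ne, Finset.singleton_inj] at hd₂
    rintro rfl
    rw [Finset.disjoint_left] at hs ht
    simp only [Finset.mem_sdiff, Finset.mem_singleton] at hs ht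
    simp only [mergeArrow, mergeNode] at hor
    grind

end IsArrowPath

/-- `σ` carries the raw path `r` to the raw path `r'`. -/
structure RawIsoBy (σ : Equiv.Perm ℕ) (r r' : RawPath V) : Prop where
  nodes : r'.nodes = r.nodes.image σ
  arrows : r'.arrows = r.arrows.image (Prod.map σ σ)
  label : ∀ v ∈ r.nodes, r'.label (σ v) = r.label v

theorem RawIsoBy.rawIso {σ : Equiv.Perm ℕ} {r r' : RawPath V} (h : RawIsoBy σ r r') :
    RawIso r r' := by
  refine ⟨σ, fun x => ?_, fun a b _ _ => ?_, h.label⟩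
  · simp [h.nodes]
  · simp [h.arrows]

theorem RawIso.refl (r : RawPath V) : RawIso r r := ⟨Equiv.refl ℕ, by simp, by simp, by simp⟩

theorem RawIso.trans {r₁ r₂ r₃ : RawPath V} (h₁ : RawIso r₁ r₂) (h₂ : RawIso r₂ r₃) :
    RawIso r₁ r₃ := by
  obtain ⟨f, hf₁, hf₂, hf₃⟩ := h₁
  obtain ⟨g, hg₁, hg₂, hg₃⟩ := h₂
  refine ⟨f.trans g, fun x => (hf₁ x).trans (hg₁ _), fun a b ha hb => ?_, fun v hv => ?_⟩
  · exact (hf₂ a b ha hb).trans (hg₂ _ _ ((hf₁ a).1 ha) ((hf₁ b).1 hb))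
  · exact (hg₃ _ ((hf₁ v).1 hv)).trans (hf₃ v hv)

theorem RawIso.symm {r₁ r₂ : RawPath V} (h : RawIso r₁ r₂) : RawIso r₂ r₁ := by
  obtain ⟨f, hf₁, hf₂, hf₃⟩ := h
  have hmem : ∀ x, x ∈ r₂.nodes ↔ f.symm x ∈ r₁.nodes := fun x => by
    rw [hf₁, Equiv.apply_symm_apply]
  refine ⟨f.symm, hmem, fun a b ha hb => ?_, fun v hv => ?_⟩
  · rw [hf₂ _ _ ((hmem a).1 ha) ((hmem b).1 hb)]
    simp
  · rw [← hf₃ _ ((hmem v).1 hv), Equiv.apply_symm_apply]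

theorem map_mergeArrow (σ : Equiv.Perm ℕ) (e p : ℕ × ℕ) :
    Prod.map σ σ (mergeArrow e p) = mergeArrow (Prod.map σ σ e) (Prod.map σ σ p) := by
  simp only [mergeArrow, mergeNode, Prod.map, σ.injective.eq_iff, apply_ite σ]

theorem RawIsoBy.glue {H : Higraph V} {σ : Equiv.Perm ℕ} {r r' : RawPath V}
    (h : RawIsoBy σ r r') (hr : IsArrowPath H r) {e : ℕ × ℕ} (he : e ∈ r.arrows) :
    RawIsoBy σ (glue r e) (glue r' (Prod.map σ σ e)) where
  nodes := by
    rw [glue_nodes, glue_nodes, h.nodes, Finset.image_erase σ.injective]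
    rfl
  arrows := by
    rw [glue_arrows, glue_arrows, h.arrows,
      ← Finset.image_erase (σ.injective.prodMap σ.injective), Finset.image_image,
      Finset.image_image]
    congr 1
    funext p
    exact (map_mergeArrow σ e p).symm
  label v hv := by
    have hend := hr.tree.endpoints e he
    have h₁ := h.label _ hend.1
    have h₂ := h.label _ hend.2
    have h₃ := h.label v (Finset.mem_of_mem_erase hv)
    simp only [_root_.glue, Prod.map, σ.injective.eq_iff, h₁, h₂, h₃]


/-- Rewrites a list of arrows of `r`, to be glued one after the other, as the list of the
images of these arrows in the successive contractions. -/
def glueTrace : List (ℕ × ℕ) → List (ℕ × ℕ)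
  | [] => []
  | e :: l => e :: glueTrace (l.map (mergeArrow e))
termination_by l => l.length
decreasing_by simp

theorem length_glueTrace (l : List (ℕ × ℕ)) : (glueTrace l).length = l.length := by
  induction hn : l.length generalizing l with
  | zero => simp [List.length_eq_zero_iff.1 hn, glueTrace]
  | succ n ih =>
    obtain ⟨e, l, rfl⟩ := List.exists_cons_of_length_eq_add_one hn
    rw [glueTrace, List.length_cons, ih _ (by simpa using hn)]

theorem glueIter_glueTrace_cons (r : RawPath V) (e : ℕ × ℕ) (l : List (ℕ × ℕ)) :
    glueIter r (glueTrace (e :: l)) =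
      glueIter (glue r e) (glueTrace (l.map (mergeArrow e))) := by
  rw [glueTrace]
  rfl

/-- `l` lists distinct arrows of `r`. -/
def IsArrowList (r : RawPath V) (l : List (ℕ × ℕ)) : Prop :=
  l.Nodup ∧ ∀ p ∈ l, p ∈ r.arrows

theorem IsArrowList.map_mergeArrow {H : Higraph V} {r : RawPath V} (hr : IsArrowPath H r)
    {e : ℕ × ℕ} {l : List (ℕ × ℕ)} (h : IsArrowList r (e :: l)) :
    IsArrowList (glue r e) (l.map (mergeArrow e)) := by
  obtain ⟨hnd, hmem⟩ := h
  rw [List.nodup_cons] at hnd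
  have hsub : ∀ p ∈ l, p ∈ r.arrows.erase e := fun p hp =>
    Finset.mem_erase.2 ⟨fun hpe => hnd.1 (hpe ▸ hp), hmem p (List.mem_cons_of_mem _ hp)⟩
  refine ⟨hnd.2.map_on fun x hx y hy hxy => ?_, fun p hp => ?_⟩
  · exact hr.tree.injOn_mergeArrow (hmem e (by simp)) (hsub x hx) (hsub y hy) hxy
  · obtain ⟨q, hq, rfl⟩ := List.mem_map.1 hp
    exact Finset.mem_image_of_mem _ (hsub q hq)

theorem RawIsoBy.glueIter {H : Higraph V} {σ : Equiv.Perm ℕ} {l : List (ℕ × ℕ)}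
    {r r' : RawPath V} (h : RawIsoBy σ r r') (hr : IsArrowPath H r) (hl : IsArrowList r l) :
    RawIsoBy σ (glueIter r (glueTrace l))
      (glueIter r' (glueTrace (l.map (Prod.map σ σ)))) := by
  induction hn : l.length generalizing l r r' with
  | zero => simpa [List.length_eq_zero_iff.1 hn, glueTrace, _root_.glueIter] using h
  | succ n ih =>
    obtain ⟨e, l, rfl⟩ := List.exists_cons_of_length_eq_add_one hn
    have he := hl.2 e (by simp)
    have := ih (h.glue hr he) (hr.glue he) (hl.map_mergeArrow hr) (by simpa using hn)
    rw [List.map_cons, glueIter_glueTrace_cons, glueIter_glueTrace_cons]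
    convert this using 3
    simp [Function.comp_def, map_mergeArrow]

/-- The relabeling of nodes that identifies the results of gluing at `e` and `f` in the two
possible orders. -/
def commPerm (e f : ℕ × ℕ) : Equiv.Perm ℕ := if e.2 = f.2 then Equiv.swap e.1 f.1 else 1

theorem commPerm_mergeNode {e f : ℕ × ℕ} (he : e.1 ≠ e.2) (hf : f.1 ≠ f.2) (hef : e ≠ f)
    (hrev : ¬ (e.1 = f.2 ∧ e.2 = f.1)) (x : ℕ) :
    commPerm e f (mergeNode (mergeArrow e f) (mergeNode e x)) =
      mergeNode (mergeArrow f e) (mergeNode f x) := by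
  obtain ⟨a, b⟩ := e
  obtain ⟨c, d⟩ := f
  simp only [ne_eq, Prod.mk.injEq] at he hf hef hrev
  simp only [commPerm, mergeArrow, mergeNode]
  by_cases hbd : b = d
  · simp only [hbd, if_true, Equiv.swap_apply_def]
    grind
  · simp only [hbd, if_false, Equiv.Perm.one_apply]
    grind

theorem rawIsoBy_glue_comm {H : Higraph V} {r : RawPath V} (hr : IsArrowPath H r)
    {e f : ℕ × ℕ} (he : e ∈ r.arrows) (hf : f ∈ r.arrows) (hef : e ≠ f) :
    RawIsoBy (commPerm e f) (glue (glue r e) (mergeArrow e f))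
      (glue (glue r f) (mergeArrow f e)) := by
  have hen := hr.tree.ne he
  have hfn := hr.tree.ne hf
  have hrev : ¬ (e.1 = f.2 ∧ e.2 = f.1) := by
    rintro ⟨h₁, h₂⟩
    refine hr.tree.swap_notMem (a := e.1) (b := e.2) he ?_
    rw [h₁, h₂]
    exact hf
  have hfe' : mergeArrow e f ∈ (glue r e).arrows :=
    Finset.mem_image_of_mem _ (Finset.mem_erase.2 ⟨hef.symm, hf⟩)
  have hef' : mergeArrow f e ∈ (glue r f).arrows :=
    Finset.mem_image_of_mem _ (Finset.mem_erase.2 ⟨hef, he⟩)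
  have hcomm := commPerm_mergeNode hen hfn hef hrev
  have hnodes : ∀ {e f : ℕ × ℕ}, e ∈ r.arrows → mergeArrow e f ∈ (glue r e).arrows →
      (glue (glue r e) (mergeArrow e f)).nodes =
        r.nodes.image (fun x => mergeNode (mergeArrow e f) (mergeNode e x)) := by
    intro e f he hf
    rw [glue_nodes, (hr.glue he).tree.erase_eq_image hf, glue_nodes,
      hr.tree.erase_eq_image he, Finset.image_image]
    rfl
  have harrows : ∀ {e f : ℕ × ℕ}, e ∈ r.arrows → f ∈ r.arrows → e ≠ f →
      (glue (glue r e) (mergeArrow e f)).arrows = ((r.arrows.erase e).erase f).image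
        (fun p => mergeArrow (mergeArrow e f) (mergeArrow e p)) := by
    intro e f he hf hef
    have hinj := hr.tree.injOn_mergeArrow he
    have hfe : f ∈ r.arrows.erase e := Finset.mem_erase.2 ⟨hef.symm, hf⟩
    have himg : ((r.arrows.erase e).image (mergeArrow e)).erase (mergeArrow e f) =
        ((r.arrows.erase e).erase f).image (mergeArrow e) := by
      ext p
      simp only [Finset.mem_erase, Finset.mem_image]
      constructor
      · rintro ⟨hp, q, hq, rfl⟩
        exact ⟨q, ⟨fun h => hp (by rw [h]), hq⟩, rfl⟩
      · rintro ⟨q, ⟨hqf, hq⟩, rfl⟩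
        exact ⟨fun h => hqf (hinj (Finset.mem_coe.2 (Finset.mem_erase.2 hq)) hfe h), q, hq, rfl⟩
    rw [glue_arrows, glue_arrows, himg, Finset.image_image]
    rfl
  refine ⟨?_, ?_, ?_⟩
  · rw [hnodes he hfe', hnodes hf hef', Finset.image_image]
    congr 1
    funext x
    exact (hcomm x).symm
  · rw [harrows he hf hef, harrows hf he hef.symm, Finset.image_image,
      Finset.erase_right_comm]
    congr 1
    funext p
    exact Prod.ext (hcomm p.1).symm (hcomm p.2).symm
  · intro v hv
    rw [hnodes he hfe', Finset.mem_image] at hv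
    obtain ⟨x, -, rfl⟩ := hv
    rw [hcomm]
    rw [glue_label, glue_label _ (mergeArrow e f), hr.breakSet_glue he hf hef.symm,
      hr.breakSet_glue hf he hef]
    simp only [glue_label]
    have hdist := hr.breakSet_ne e he f hf hef
    obtain ⟨K, hK, hK₁, hK₂, hKs, hKt, -⟩ := hr.exists_break he
    obtain ⟨L, hL, hL₁, hL₂, hLs, hLt, -⟩ := hr.exists_break hf
    rw [hK, hL, Ne, Finset.singleton_inj] at hdist
    rw [hK, hL]
    clear hcomm hnodes harrows hfe' hef' hK hL he hf hr
    obtain ⟨a, b⟩ := e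
    obtain ⟨c, d⟩ := f
    rw [Finset.disjoint_left] at hKs hKt hLs hLt
    simp only [Finset.mem_sdiff, Finset.mem_singleton, Prod.mk.injEq, ne_eq] at *
    simp only [mergeArrow, mergeNode]
    by_cases hac : a = c
    · subst hac
      have hbd : b ≠ d := fun h => hef ⟨rfl, h⟩
      have h₁ : d ≠ b := hbd.symm
      have h₂ : b ≠ a := Ne.symm hen
      have h₃ : d ≠ a := Ne.symm hfn
      by_cases hx : x = a ∨ x = b ∨ x = d
      · rcases hx with rfl | rfl | rfl <;> simp [*] <;> constructor <;> ext v <;> grind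
      · simp [not_or.1 hx, *]; grind
    by_cases hbd : b = d
    · subst hbd
      have h₂ : b ≠ a := Ne.symm hen
      have h₃ : b ≠ c := Ne.symm hfn
      have h₄ : c ≠ a := Ne.symm hac
      by_cases hx : x = a ∨ x = b ∨ x = c
      · rcases hx with rfl | rfl | rfl <;> simp [*] <;> constructor <;> ext v <;> grind
      · simp [not_or.1 hx, *]; grind
    by_cases hbc : b = c
    · subst hbc
      have h₂ : b ≠ a := Ne.symm hen
      have h₃ : d ≠ b := Ne.symm hfn
      have h₄ : a ≠ d := fun h => hrev ⟨h, rfl⟩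
      by_cases hx : x = a ∨ x = b ∨ x = d
      · rcases hx with rfl | rfl | rfl <;> simp [*] <;> constructor <;> ext v <;> grind
      · simp [not_or.1 hx, *]; grind
    by_cases had : a = d
    · subst had
      have h₂ : b ≠ a := Ne.symm hen
      have h₃ : a ≠ c := Ne.symm hfn
      have h₄ : c ≠ b := Ne.symm hbc
      by_cases hx : x = a ∨ x = b ∨ x = c
      · rcases hx with rfl | rfl | rfl <;> simp [*] <;> constructor <;> ext v <;> grind
      · simp [not_or.1 hx, *]; grind
    grind

theorem rawIso_glueIter_of_perm {H : Higraph V} {r : RawPath V} {l₁ l₂ : List (ℕ × ℕ)}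
    (hr : IsArrowPath H r) (hl : IsArrowList r l₁) (hp : l₁.Perm l₂) :
    RawIso (glueIter r (glueTrace l₁)) (glueIter r (glueTrace l₂)) := by
  induction hn : l₁.length generalizing r l₁ l₂ with
  | zero =>
    obtain rfl := List.length_eq_zero_iff.1 hn
    rw [List.nil_perm.1 hp]
    exact .refl _
  | succ n ih =>
    induction hp with
    | nil => simp at hn
    | cons e hp =>
      rw [glueIter_glueTrace_cons, glueIter_glueTrace_cons]
      exact ih (hr.glue (hl.2 e (by simp))) (hl.map_mergeArrow hr) (hp.map _) (by simpa using hn)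
    | swap e f l =>
      have he := hl.2 e (by simp)
      have hf := hl.2 f (by simp)
      have hfe : f ≠ e := fun h => by simpa [h] using hl.1
      have hl' := hl.map_mergeArrow hr
      rw [List.map_cons] at hl'
      have hf' := hl'.2 _ List.mem_cons_self
      rw [glueIter_glueTrace_cons, glueIter_glueTrace_cons, List.map_cons, List.map_cons,
        glueIter_glueTrace_cons, glueIter_glueTrace_cons]
      have := ((rawIsoBy_glue_comm hr hf he hfe).glueIter ((hr.glue hf).glue hf')
        (hl'.map_mergeArrow (hr.glue hf))).rawIso
      convert this using 3
      simp only [List.map_map]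
      congr 1
      have hrev : ¬ (f.1 = e.2 ∧ f.2 = e.1) := by
        rintro ⟨h₁, h₂⟩
        refine hr.tree.swap_notMem (a := f.1) (b := f.2) hf ?_
        rw [h₁, h₂]
        exact he
      funext p
      have hcomm := commPerm_mergeNode (hr.tree.ne hf) (hr.tree.ne he) hfe hrev
      exact Prod.ext (hcomm p.1).symm (hcomm p.2).symm
    | trans hp₁ hp₂ ih₁ ih₂ =>
      refine (ih₁ hl hn).trans (ih₂ ⟨hp₁.nodup hl.1, fun p hp => hl.2 p (hp₁.mem_iff.2 hp)⟩ ?_)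
      rw [← hp₁.length_eq, hn]

theorem IsArrowList.isGlueSeq {H : Higraph V} {r : RawPath V} {l : List (ℕ × ℕ)}
    (hr : IsArrowPath H r) (hl : IsArrowList r l) : IsGlueSeq r (glueTrace l) := by
  induction hn : l.length generalizing r l with
  | zero => simp [List.length_eq_zero_iff.1 hn, glueTrace, IsGlueSeq]
  | succ n ih =>
    obtain ⟨e, l, rfl⟩ := List.exists_cons_of_length_eq_add_one hn
    have he := hl.2 e (by simp)
    rw [glueTrace]
    exact ⟨he, ih (hr.glue he) (hl.map_mergeArrow hr) (by simpa using hn)⟩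

theorem IsGlueSeq.exists_glueTrace_eq {r : RawPath V} {m : List (ℕ × ℕ)}
    (hm : IsGlueSeq r m) : ∃ l, IsArrowList r l ∧ glueTrace l = m := by
  induction m generalizing r with
  | nil => exact ⟨[], ⟨List.nodup_nil, by simp⟩, by simp [glueTrace]⟩
  | cons e m ih =>
    obtain ⟨l, ⟨hnd, hl⟩, rfl⟩ := ih hm.2
    have : ∀ l : List (ℕ × ℕ), (∀ p ∈ l, p ∈ (glue r e).arrows) →
        ∃ l' : List (ℕ × ℕ), (∀ p ∈ l', p ∈ r.arrows.erase e) ∧ l'.map (mergeArrow e) = l := by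
      intro l hl
      induction l with
      | nil => exact ⟨[], by simp, rfl⟩
      | cons p l ih =>
        obtain ⟨l', hl', rfl⟩ := ih fun q hq => hl q (List.mem_cons_of_mem _ hq)
        obtain ⟨q, hq, rfl⟩ := Finset.mem_image.1 (hl p List.mem_cons_self)
        exact ⟨q :: l', List.forall_mem_cons.2 ⟨hq, hl'⟩, rfl⟩
    obtain ⟨l', hl', rfl⟩ := this l hl
    refine ⟨e :: l', ⟨List.nodup_cons.2 ⟨fun h => ?_, hnd.of_map _⟩, ?_⟩, by rw [glueTrace]⟩
    · exact Finset.notMem_erase e _ (hl' e h)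
    · exact List.forall_mem_cons.2 ⟨hm.1, fun p hp => Finset.mem_of_mem_erase (hl' p hp)⟩

theorem list_eq_of_map_eq {α β : Type*} {f : α → β} {A : Finset α} (hf : Set.InjOn f A)
    {l l' : List α} (hl : ∀ p ∈ l, p ∈ A) (hl' : ∀ p ∈ l', p ∈ A) (h : l.map f = l'.map f) :
    l = l' := by
  induction l generalizing l' with
  | nil => simpa [eq_comm] using h
  | cons p l ih =>
    cases l' with
    | nil => simp at h
    | cons p' l' =>
      rw [List.forall_mem_cons] at hl hl'
      rw [List.map_cons, List.map_cons, List.cons.injEq] at h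
      rw [hf hl.1 hl'.1 h.1, ih hl.2 hl'.2 h.2]

theorem injOn_glueTrace {H : Higraph V} {r : RawPath V} (hr : IsArrowPath H r) :
    Set.InjOn glueTrace {l | IsArrowList r l} := by
  intro l hl
  induction hn : l.length generalizing r l with
  | zero =>
    intro l' _ h
    have := congrArg List.length h
    rw [length_glueTrace, length_glueTrace, hn] at this
    rw [List.length_eq_zero_iff.1 hn, List.length_eq_zero_iff.1 this.symm]
  | succ n ih =>
    intro l' hl' h
    have hlen := congrArg List.length h
    rw [length_glueTrace, length_glueTrace, hn] at hlen
    obtain ⟨e, l, rfl⟩ := List.exists_cons_of_length_eq_add_one hn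
    obtain ⟨e', l', rfl⟩ := List.exists_cons_of_length_eq_add_one hlen.symm
    rw [glueTrace, glueTrace, List.cons.injEq] at h
    obtain ⟨rfl, h⟩ := h
    have he := hl.2 e (by simp)
    have hmap := ih (hr.glue he) (hl.map_mergeArrow hr) (by simpa using hn)
      (hl'.map_mergeArrow hr) h
    have hmem : ∀ m, IsArrowList r (e :: m) → ∀ p ∈ m, p ∈ r.arrows.erase e :=
      fun m hm p hp => Finset.mem_erase.2
        ⟨fun hpe => (List.nodup_cons.1 hm.1).1 (hpe ▸ hp), hm.2 p (List.mem_cons_of_mem _ hp)⟩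
    have hinj := hr.tree.injOn_mergeArrow he
    rw [list_eq_of_map_eq hinj (hmem l hl) (hmem l' hl') hmap]

/-- A permutation-invariant family of lists of length `k` of distinct elements of a finite set
has cardinality divisible by `k!`. -/
theorem factorial_dvd_ncard_of_perm {α : Type*} (A : Finset α) (k : ℕ) (P : List α → Prop)
    (hP : ∀ l, P l → l.length = k ∧ l.Nodup ∧ ∀ p ∈ l, p ∈ A)
    (hperm : ∀ l₁ l₂, P l₁ → l₁.Perm l₂ → P l₂) :
    Nat.factorial k ∣ Set.ncard {l | P l} := by
  have hfin : {l | P l}.Finite := by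
    refine ((A.powersetCard k).biUnion fun S => S.toList.permutations.toFinset).finite_toSet.subset
      fun l hl => ?_
    obtain ⟨hk, hnd, hA⟩ := hP l hl
    simp only [Finset.coe_biUnion, Set.mem_iUnion, Finset.mem_coe, List.mem_toFinset,
      List.mem_permutations, Finset.mem_powersetCard]
    refine ⟨l.toFinset, ⟨fun p hp => hA p (List.mem_toFinset.1 hp), ?_⟩,
      (List.toFinset_toList hnd).symm⟩
    rw [List.toFinset_card_of_nodup hnd, hk]
  rw [Set.ncard_eq_toFinset_card _ hfin,
    Finset.card_eq_sum_card_image (fun l : List α => l.toFinset)]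
  refine Finset.dvd_sum fun S hS => ?_
  obtain ⟨m, hm, rfl⟩ := Finset.mem_image.1 hS
  rw [Set.Finite.mem_toFinset] at hm
  obtain ⟨hk, hnd, -⟩ := hP m hm
  have : (hfin.toFinset.filter fun l => l.toFinset = m.toFinset) =
      m.permutations.toFinset := by
    ext l
    simp only [Finset.mem_filter, Set.Finite.mem_toFinset, Set.mem_ofPred_eq, List.mem_toFinset,
      List.mem_permutations]
    constructor
    · rintro ⟨hl, h⟩
      exact List.perm_of_nodup_nodup_toFinset_eq (hP l hl).2.1 hnd h
    · intro h
      exact ⟨hperm _ _ hm h.symm, List.toFinset_eq_of_perm _ _ h⟩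
  rw [this, List.toFinset_card_of_nodup (List.nodup_permutations _ hnd),
    List.length_permutations, hk]

/-- For fixed paths `ρ`, `ρ'` in a higraph and `k ≥ 1`, the number of `k`-step
gluing sequences starting at `ρ` and terminating at (a path isomorphic to) `ρ'` is a multiple
of `k!`. -/
theorem factorial_dvd_card_gluing_sequences
    (H : Higraph V) (ρ ρ' : RawPath V) (hρ : IsPath H ρ) (hρ' : IsPath H ρ')
    (k : ℕ) (hk : 1 ≤ k) :
    Nat.factorial k ∣
      Set.ncard {l : List (ℕ × ℕ) |
        l.length = k ∧ IsGlueSeq ρ l ∧ RawIso (glueIter ρ l) ρ'} := by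
  have hr := hρ.isArrowPath
  have himg : {l : List (ℕ × ℕ) | l.length = k ∧ IsGlueSeq ρ l ∧ RawIso (glueIter ρ l) ρ'} =
      Set.image glueTrace {l | l.length = k ∧ IsArrowList ρ l ∧
        RawIso (glueIter ρ (glueTrace l)) ρ'} := by
    ext m
    constructor
    · rintro ⟨hlen, hseq, hiso⟩
      obtain ⟨l, hl, rfl⟩ := hseq.exists_glueTrace_eq
      exact ⟨l, ⟨by rwa [length_glueTrace] at hlen, hl, hiso⟩, rfl⟩
    · rintro ⟨l, ⟨hlen, hl, hiso⟩, rfl⟩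
      exact ⟨by rwa [length_glueTrace], hl.isGlueSeq hr, hiso⟩
  rw [himg, Set.InjOn.ncard_image ((injOn_glueTrace hr).mono fun l hl => hl.2.1)]
  refine factorial_dvd_ncard_of_perm ρ.arrows k _ (fun l hl => ⟨hl.1, hl.2.1⟩) ?_
  rintro l₁ l₂ ⟨hlen, hl, hiso⟩ hp
  exact ⟨hp.length_eq ▸ hlen, ⟨hp.nodup hl.1, fun p h => hl.2 p (hp.mem_iff.2 h)⟩,
    (rawIso_glueIter_of_perm hr hl hp).symm.trans hiso⟩
end
end

section
/- The automorphism group of any path in a higraph is trivial: if f : T → T is a digraph automorphism of the directed tree underlying a path ρ satisfying ρ ∘ f = ρ, then f is the identity. Consequently paths in a higraph are unique up to unique isomorphism. -/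
/-!
Statement 3: The automorphism group of any path in a higraph is trivial, and consequently
paths in a higraph are unique up to unique isomorphism.
-/

open scoped Classical

noncomputable section

variable {V : Type*}

/-- `f` is an isomorphism from the path `r₁` to the path `r₂`: a digraph isomorphism of the
underlying directed trees commuting with the labelings. -/
def IsIsoWitness (f : Equiv.Perm ℕ) (r₁ r₂ : RawPath V) : Prop :=
  (∀ x : ℕ, x ∈ r₁.nodes ↔ f x ∈ r₂.nodes) ∧
  (∀ a b : ℕ, a ∈ r₁.nodes → b ∈ r₁.nodes →
    ((a, b) ∈ r₁.arrows ↔ (f a, f b) ∈ r₂.arrows)) ∧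
  (∀ v ∈ r₁.nodes, r₂.label (f v) = r₁.label v)

/-- An automorphism of a finite tree fixes a vertex or flips an edge. -/
theorem SimpleGraph.IsTree.exists_fixed_or_flip {W : Type*} [Fintype W] {G : SimpleGraph W}
    (hG : G.IsTree) (f : G ≃g G) :
    (∃ x, f x = x) ∨ ∃ x y, G.Adj x y ∧ f x = y ∧ f y = x := by
  by_contra! ⟨hfix, hflip⟩
  have hstep : ∀ x, ∃ y, ∃ _ : G.Adj x y, ∃ q : G.Walk y (f x), q.length + 1 = G.dist x (f x) := by
    intro x
    obtain ⟨p, hp⟩ := (hG.connected x (f x)).exists_walk_length_eq_dist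
    have hne := hfix x
    generalize f x = u at *
    cases p with
    | nil => exact absurd rfl hne
    | cons h q => exact ⟨_, h, q, by simpa using hp⟩
  choose g hadj q hq using hstep
  have hcard : Fintype.card G.edgeSet < Fintype.card W := by
    have := hG.card_edgeFinset
    rw [SimpleGraph.edgeFinset_card] at this
    omega
  obtain ⟨x, y, hxy, heq⟩ := Fintype.exists_ne_map_eq_of_card_lt
    (fun x => (⟨s(x, g x), hadj x⟩ : G.edgeSet)) hcard
  have hgx : g x = y ∧ g y = x := by
    have := congrArg Subtype.val heq
    simp only [Sym2.eq_iff] at this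
    grind
  have hx : ∃ q : G.Walk y (f x), q.length + 1 = G.dist x (f x) := hgx.1 ▸ ⟨q x, hq x⟩
  have hy : ∃ q : G.Walk x (f y), q.length + 1 = G.dist y (f y) := hgx.2 ▸ ⟨q y, hq y⟩
  have hA : G.Adj x y := hgx.1 ▸ hadj x
  have hA' : G.Adj (f y) (f x) := (f.map_adj_iff.2 hA).symm
  have hne := hflip x y hA
  obtain ⟨q, hq⟩ := hx
  obtain ⟨p, hp⟩ := hy
  generalize f x = u at *
  generalize f y = v at *
  have h₁ := SimpleGraph.dist_le (p.concat hA')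
  have h₂ := SimpleGraph.dist_le (q.concat hA'.symm)
  rw [SimpleGraph.Walk.length_concat] at h₁ h₂
  have hpP : (p.concat hA').IsPath :=
    SimpleGraph.Walk.isPath_of_length_eq_dist _ (by rw [SimpleGraph.Walk.length_concat]; omega)
  have hqP : (SimpleGraph.Walk.cons hA q).IsPath :=
    SimpleGraph.Walk.isPath_of_length_eq_dist _ (by rw [SimpleGraph.Walk.length_cons]; omega)
  have key : p.concat hA' = SimpleGraph.Walk.cons hA q :=
    congrArg Subtype.val ((hG.isAcyclic.subsingleton_path _ _).elim ⟨_, hpP⟩ ⟨_, hqP⟩)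
  cases p with
  | nil =>
    simp only [SimpleGraph.Walk.length_nil] at hp h₁
    exact hne (SimpleGraph.Walk.eq_of_length_eq_zero (p := q) (by omega)).symm rfl
  | cons h p' =>
    rw [SimpleGraph.Walk.concat_cons] at key
    injection key with _ hzy
    subst hzy
    have := SimpleGraph.dist_le p'
    simp only [SimpleGraph.Walk.length_cons] at hp
    omega

/-- The automorphism of the underlying undirected graph induced by a path automorphism. -/
def IsIsoWitness.graphIso {r : RawPath V} {f : Equiv.Perm ℕ} (hf : IsIsoWitness f r r) :
    r.graph ≃g r.graph where
  toEquiv := f.subtypeEquiv hf.1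
  map_rel_iff' := by
    rintro ⟨a, ha⟩ ⟨b, hb⟩
    simp [RawPath.graph, SimpleGraph.fromRel_adj, hf.2.1 a b ha hb, hf.2.1 b a hb ha]

theorem IsIsoWitness.coe_graphIso {r : RawPath V} {f : Equiv.Perm ℕ} (hf : IsIsoWitness f r r)
    (x : {x // x ∈ r.nodes}) : (hf.graphIso x : ℕ) = f x := rfl

theorem RawPath.graph_adj {r : RawPath V} {a b : {x // x ∈ r.nodes}} :
    r.graph.Adj a b ↔ a ≠ b ∧ (((a : ℕ), (b : ℕ)) ∈ r.arrows ∨ ((b : ℕ), (a : ℕ)) ∈ r.arrows) :=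
  SimpleGraph.fromRel_adj _ _ _

/-- A path automorphism fixing a node fixes all of its neighbours. -/
theorem IsPath.fixed_of_adj {H : Higraph V} {r : RawPath V} (hr : IsPath H r) {f : Equiv.Perm ℕ}
    (hf : IsIsoWitness f r r) {a b : {x // x ∈ r.nodes}} (hab : r.graph.Adj a b)
    (ha : f a = a) : f b = b := by
  obtain ⟨-, -, -, hinj⟩ := hr
  obtain ⟨-, harr, hlab⟩ := hf
  by_contra hb
  rcases (RawPath.graph_adj.1 hab).2 with h | h
  · have h' := (harr a b a.2 b.2).1 h
    rw [ha] at h'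
    refine hinj _ h _ h' (fun e => hb (congrArg Prod.snd e).symm) (Or.inl rfl) ?_
    rw [hlab b b.2]
  · have h' := (harr b a b.2 a.2).1 h
    rw [ha] at h'
    refine hinj _ h _ h' (fun e => hb (congrArg Prod.fst e).symm) (Or.inr rfl) ?_
    rw [hlab b b.2]

/-- A path automorphism fixes some node, since a directed edge cannot be flipped. -/
theorem IsPath.exists_fixed {H : Higraph V} {r : RawPath V} (hr : IsPath H r) {f : Equiv.Perm ℕ}
    (hf : IsIsoWitness f r r) : ∃ x : {x // x ∈ r.nodes}, f x = x := by
  obtain ⟨-, -, hasymm, htree⟩ := hr.1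
  rcases htree.exists_fixed_or_flip hf.graphIso with ⟨x, hx⟩ | ⟨x, y, hxy, hx, hy⟩
  · exact ⟨x, congrArg Subtype.val hx⟩
  · have hx' : f x = y := congrArg Subtype.val hx
    have hy' : f y = x := congrArg Subtype.val hy
    rcases (RawPath.graph_adj.1 hxy).2 with h | h
    · have h' := (hf.2.1 x y x.2 y.2).1 h
      rw [hx', hy'] at h'
      exact absurd h' (hasymm _ _ h)
    · have h' := (hf.2.1 y x y.2 x.2).1 h
      rw [hx', hy'] at h'
      exact absurd h' (hasymm _ _ h)

theorem IsPath.automorphism_apply {H : Higraph V} {r : RawPath V} (hr : IsPath H r)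
    {f : Equiv.Perm ℕ} (hf : IsIsoWitness f r r) {x : ℕ} (hx : x ∈ r.nodes) : f x = x := by
  obtain ⟨c, hc⟩ := hr.exists_fixed hf
  obtain ⟨w⟩ := hr.1.2.2.2.connected c ⟨x, hx⟩
  have hwalk : ∀ {a b : {x // x ∈ r.nodes}}, r.graph.Walk a b → f a = a → f b = b := by
    intro a b w
    induction w with
    | nil => exact id
    | cons h _ ih => exact fun ha => ih (hr.fixed_of_adj hf h ha)
  exact hwalk w hc

theorem IsIsoWitness.trans_symm {r₁ r₂ : RawPath V} {f g : Equiv.Perm ℕ}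
    (hf : IsIsoWitness f r₁ r₂) (hg : IsIsoWitness g r₁ r₂) :
    IsIsoWitness (f.trans g.symm) r₁ r₁ := by
  have hmem : ∀ x, x ∈ r₁.nodes ↔ g.symm (f x) ∈ r₁.nodes := fun x => by
    rw [hg.1 (g.symm (f x)), g.apply_symm_apply, hf.1]
  refine ⟨hmem, fun a b ha hb => ?_, fun v hv => ?_⟩
  · rw [hf.2.1 a b ha hb, Equiv.trans_apply, Equiv.trans_apply,
      hg.2.1 _ _ ((hmem a).1 ha) ((hmem b).1 hb), g.apply_symm_apply, g.apply_symm_apply]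
  · rw [Equiv.trans_apply, ← hg.2.2 _ ((hmem v).1 hv), g.apply_symm_apply, hf.2.2 v hv]

/-- Every automorphism of a path in a higraph is the identity; consequently
any two isomorphisms between two paths in a higraph agree, i.e. paths are unique up to unique
isomorphism. -/
theorem path_automorphism_group_trivial (H : Higraph V) :
    (∀ r : RawPath V, IsPath H r → ∀ f : Equiv.Perm ℕ, IsIsoWitness f r r →
      ∀ x ∈ r.nodes, f x = x) ∧
    (∀ r₁ r₂ : RawPath V, IsPath H r₁ → IsPath H r₂ →
      ∀ f g : Equiv.Perm ℕ, IsIsoWitness f r₁ r₂ → IsIsoWitness g r₁ r₂ →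
      ∀ x ∈ r₁.nodes, f x = g x) := by
  exact ⟨fun r hr f hf x hx => hr.automorphism_apply hf hx, fun r₁ r₂ h₁ _ f g hf hg x hx =>
    (Equiv.symm_apply_eq g).1 (h₁.automorphism_apply (hf.trans_symm hg) hx)⟩
end
end
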